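/- Let X be a Banach space and F : 𝓕 → X be almost-additive with boundary term b (with constant D such that b(Q) ≤ D|Q|) and bounded with constant C. Fix M ∈ ℕ with M ≥ 1, Q ∈ 𝓕 a box, and x ∈ ℤ^d. With ℤ_{x,M} := x + (Mℤ)^d, I_{Q,x,M} := {a ∈ ℤ_{x,M} : C_M(a) ⊂ Q} and D_{Q,x,M} := {a ∈ ℤ_{x,M} : C_M(a) ∩ Q ≠ ∅ and C_M(a) ⊄ Q}, one has ‖F(Q) − Σ_{a∈I_{Q,x,M}} F(C_M(a))‖ ≤ |Q|·b(C_M)/|C_M| + |D_{Q,x,M}|·(C+D)·|C_M|. -/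

import Mathlib

open Filter
noncomputable section

/-- `ℤ^d`. -/
abbrev Zd (d : ℕ) := Fin d → ℤ

namespace IDSZd

variable {d : ℕ} {A : Type*} {X : Type*}

/-- The ℓ∞ (maximum) distance on `ℤ^d`, as a natural number. -/
def dInf (x y : Zd d) : ℕ := Finset.univ.sup fun j => (x j - y j).natAbs

/-- The closed ℓ∞-ball of radius `S` around `q`, as a finset. -/
def ball (q : Zd d) (S : ℕ) : Finset (Zd d) :=
  Fintype.piFinset fun j => Finset.Icc (q j - S) (q j + S)

open Classical in
/-- The `S`-boundary `∂^S Q` of a finite set `Q ⊆ ℤ^d`:  points outside `Q` within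
distance `S` of `Q` together with points of `Q` within distance `S` of the complement. -/
def sBdry (S : ℕ) (Q : Finset (Zd d)) : Finset (Zd d) :=
  ((Q.biUnion fun q => ball q S).filter fun x => x ∉ Q) ∪
    (Q.filter fun x => ∃ y : Zd d, y ∉ Q ∧ dInf x y ≤ S)

/-- A van Hove sequence of (nonempty) finite subsets of `ℤ^d`. -/
def VanHove (Q : ℕ → Finset (Zd d)) : Prop :=
  (∀ j, (Q j).Nonempty) ∧
    ∀ S : ℕ, Tendsto (fun j => ((sBdry S (Q j)).card : ℝ) / ((Q j).card : ℝ)) atTop (nhds 0)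

/-- The translate `t + Q` of a finite set `Q ⊆ ℤ^d`. -/
def shift (t : Zd d) (Q : Finset (Zd d)) : Finset (Zd d) := Q.image (t + ·)

/-- The box `C_M = {0, …, M−1}^d`. -/
def cube (d M : ℕ) : Finset (Zd d) := Fintype.piFinset fun _ => Finset.Ico (0 : ℤ) (M : ℤ)

/-- A box `[a₁,b₁] × ⋯ × [a_d,b_d]` in `ℤ^d`. -/
def IsBox (Q : Finset (Zd d)) : Prop :=
  ∃ a b : Zd d, (∀ j, a j ≤ b j) ∧ Q = Fintype.piFinset fun j => Finset.Icc (a j) (b j)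

/-- A box at the origin, i.e. `[0,b₁] × ⋯ × [0,b_d]`. -/
def IsBoxAtOrigin (Q : Finset (Zd d)) : Prop :=
  ∃ b : Zd d, (∀ j, 0 ≤ b j) ∧ Q = Fintype.piFinset fun j => Finset.Icc 0 (b j)

open Classical in
/-- The number of occurrences `♯_P P'` of the pattern `P` with domain `B` (given by a
total function) in the pattern `P'` with domain `Q` given by the total function `L`. -/
def occ (B : Finset (Zd d)) (P : Zd d → A) (Q : Finset (Zd d)) (L : Zd d → A) : ℕ :=
  (Q.filter fun x => shift x B ⊆ Q ∧ ∀ y ∈ B, L (x + y) = P y).card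

/-- Extension of a pattern `P` with domain `B` to a total function on `ℤ^d`
(by a junk value taken from the colouring `Λ`). -/
def extPat (Λ : Zd d → A) (B : Finset (Zd d)) (P : ↥B → A) : Zd d → A :=
  fun y => if h : y ∈ B then P ⟨y, h⟩ else Λ 0

/-- `ν` is the frequency function of the colouring `Λ` along the sequence `Q`:
for every box pattern at the origin the frequency exists and is given by `ν`. -/
def Freqs (Λ : Zd d → A) (Q : ℕ → Finset (Zd d)) (ν : Finset (Zd d) → (Zd d → A) → ℝ) : Prop :=
  ∀ B : Finset (Zd d), IsBoxAtOrigin B → ∀ P : Zd d → A,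
    Tendsto (fun j => (occ B P (Q j) Λ : ℝ) / ((Q j).card : ℝ)) atTop (nhds (ν B P))

/-- A boundary term with constant `D`. -/
def IsBoundaryTerm (b : Finset (Zd d) → ℝ) (D : ℝ) : Prop :=
  (∀ Q, 0 ≤ b Q) ∧ (∀ t Q, b (shift t Q) = b Q) ∧
    (∀ Q : ℕ → Finset (Zd d), VanHove Q →
      Tendsto (fun j => b (Q j) / ((Q j).card : ℝ)) atTop (nhds 0)) ∧
    0 < D ∧ ∀ Q : Finset (Zd d), b Q ≤ D * Q.card

section NormedX
variable [NormedAddCommGroup X]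

/-- Almost additivity of `F` with boundary term `b`. -/
def AlmostAdditive (F : Finset (Zd d) → X) (b : Finset (Zd d) → ℝ) : Prop :=
  ∀ (m : ℕ) (Qs : Fin m → Finset (Zd d)), (∀ k l, k ≠ l → Disjoint (Qs k) (Qs l)) →
    ‖F (Finset.univ.biUnion Qs) - ∑ k, F (Qs k)‖ ≤ ∑ k, b (Qs k)

/-- `Λ`-invariance of `F`. -/
def Invariant (Λ : Zd d → A) (F : Finset (Zd d) → X) : Prop :=
  ∀ (t : Zd d) (Q : Finset (Zd d)), (∀ y ∈ Q, Λ (t + y) = Λ y) → F (shift t Q) = F Q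

/-- `Ft` is the map on box patterns at the origin (given by domain and total function,
depending only on the restriction of the function to the domain) induced by the
`Λ`-invariant map `F`. -/
def IsInducedMap (Λ : Zd d → A) (F : Finset (Zd d) → X)
    (Ft : Finset (Zd d) → (Zd d → A) → X) : Prop :=
  (∀ (B : Finset (Zd d)) (P P' : Zd d → A), (∀ y ∈ B, P y = P' y) → Ft B P = Ft B P') ∧
    ∀ (t : Zd d) (Q : Finset (Zd d)), IsBoxAtOrigin Q →
      F (shift t Q) = Ft Q fun y => Λ (t + y)

/-- Boundedness of `F` with constant `C`. -/
def Bounded (F : Finset (Zd d) → X) (C : ℝ) : Prop := ∀ Q : Finset (Zd d), ‖F Q‖ ≤ C * Q.card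

/-- The pattern average `Σ_{P ∈ 𝓟_M} ν_P F̃(P) / |C_M|`. -/
def patAvg [NormedSpace ℝ X] [Fintype A] (Λ : Zd d → A)
    (ν : Finset (Zd d) → (Zd d → A) → ℝ) (Ft : Finset (Zd d) → (Zd d → A) → X) (M : ℕ) : X :=
  (((cube d M).card : ℝ))⁻¹ • ∑ P : ↥(cube d M) → A,
    ν (cube d M) (extPat Λ (cube d M) P) • Ft (cube d M) (extPat Λ (cube d M) P)

end NormedX

/-- The set of shifts `a` with `C_M(a) ∩ Q ≠ ∅`. -/
def coverShifts (Q : Finset (Zd d)) (M : ℕ) : Finset (Zd d) :=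
  Q.biUnion fun q => Fintype.piFinset fun j => Finset.Ioc (q j - M) (q j)

/-- The set `D_{Q,x,M}` of lattice shifts `a ∈ x + (Mℤ)^d` whose box `C_M(a)` meets `Q`
but is not contained in `Q`. -/
def latticeD (Q : Finset (Zd d)) (x : Zd d) (M : ℕ) : Finset (Zd d) :=
  (coverShifts Q M).filter fun a => (∀ j, (M : ℤ) ∣ (a j - x j)) ∧ ¬ shift a (cube d M) ⊆ Q

/-- The set `I_{Q,x,M}` of lattice shifts `a ∈ x + (Mℤ)^d` with `C_M(a) ⊆ Q` (for `M ≥ 1`). -/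
def latticeI (Q : Finset (Zd d)) (x : Zd d) (M : ℕ) : Finset (Zd d) :=
  (coverShifts Q M).filter fun a => (∀ j, (M : ℤ) ∣ (a j - x j)) ∧ shift a (cube d M) ⊆ Q


lemma mem_shift_cube (a y : Zd d) (M : ℕ) :
    y ∈ shift a (cube d M) ↔ ∀ j, a j ≤ y j ∧ y j < a j + M := by
  simp only [shift, cube, Finset.mem_image, Fintype.mem_piFinset, Finset.mem_Ico]
  constructor
  · rintro ⟨z, hz, rfl⟩ j
    have := hz j
    simp only [Pi.add_apply]
    omega
  · intro h
    refine ⟨y - a, fun j => ?_, by simp⟩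
    have := h j
    simp only [Pi.sub_apply]
    omega

lemma card_shift (a : Zd d) (Q : Finset (Zd d)) : (shift a Q).card = Q.card :=
  Finset.card_image_of_injective _ (add_right_injective a)

lemma mem_coverShifts (Q : Finset (Zd d)) (a : Zd d) (M : ℕ) :
    a ∈ coverShifts Q M ↔ ∃ q ∈ Q, q ∈ shift a (cube d M) := by
  simp only [coverShifts, Finset.mem_biUnion, Fintype.mem_piFinset, Finset.mem_Ioc,
    mem_shift_cube]
  refine exists_congr fun q => and_congr_right fun _ => forall_congr' fun j => ?_
  omega

lemma lattice_unique (x a a' y : Zd d) (M : ℕ)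
    (ha : ∀ j, (M : ℤ) ∣ (a j - x j)) (ha' : ∀ j, (M : ℤ) ∣ (a' j - x j))
    (h : y ∈ shift a (cube d M)) (h' : y ∈ shift a' (cube d M)) : a = a' := by
  rw [mem_shift_cube] at h h'
  funext j
  have h1 := h j
  have h2 := h' j
  have h3 : (M : ℤ) ∣ a j - a' j := by
    have := dvd_sub (ha j) (ha' j)
    simpa using this
  have h4 := Int.eq_zero_of_abs_lt_dvd h3 (by rw [abs_lt]; omega)
  omega

lemma lattice_exists (x y : Zd d) (M : ℕ) (hM : 1 ≤ M) :
    ∃ a : Zd d, (∀ j, (M : ℤ) ∣ (a j - x j)) ∧ y ∈ shift a (cube d M) := by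
  refine ⟨fun j => y j - (y j - x j) % M, fun j => ?_, ?_⟩
  · refine ⟨(y j - x j) / M, ?_⟩
    have := Int.emod_add_mul_ediv (y j - x j) M
    linarith
  · rw [mem_shift_cube]
    intro j
    have h1 := Int.emod_nonneg (y j - x j) (b := (M : ℤ)) (by omega)
    have h2 := Int.emod_lt_of_pos (y j - x j) (b := (M : ℤ)) (by omega)
    constructor <;> linarith

lemma almostAdditive_finset {X : Type*} [NormedAddCommGroup X]
    {F : Finset (Zd d) → X} {b : Finset (Zd d) → ℝ} (hAA : AlmostAdditive F b)
    (s : Finset (Zd d)) (f : Zd d → Finset (Zd d))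
    (hf : ∀ a ∈ s, ∀ a' ∈ s, a ≠ a' → Disjoint (f a) (f a')) :
    ‖F (s.biUnion f) - ∑ a ∈ s, F (f a)‖ ≤ ∑ a ∈ s, b (f a) := by
  have h := hAA s.card (fun k => f (s.equivFin.symm k)) (fun k l hkl =>
    hf _ (s.equivFin.symm k).2 _ (s.equivFin.symm l).2
      (fun e => hkl (s.equivFin.symm.injective (Subtype.ext e))))
  have e1 : (Finset.univ.biUnion fun k => f (s.equivFin.symm k)) = s.biUnion f := by
    ext y
    simp only [Finset.mem_biUnion, Finset.mem_univ, true_and]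
    constructor
    · rintro ⟨k, hk⟩
      exact ⟨_, (s.equivFin.symm k).2, hk⟩
    · rintro ⟨a, ha, hy⟩
      exact ⟨s.equivFin ⟨a, ha⟩, by simpa using hy⟩
  have e2 : ∀ {Y : Type _} [AddCommMonoid Y] (g : Finset (Zd d) → Y),
      ∑ k, g (f (s.equivFin.symm k)) = ∑ a ∈ s, g (f a) := by
    intro Y _ g
    rw [← Finset.sum_coe_sort s (fun a => g (f a))]
    exact Equiv.sum_comp s.equivFin.symm (fun a : s => g (f a))
  have e3 : ∑ k, b (f (s.equivFin.symm k)) = ∑ a ∈ s, b (f a) := by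
    rw [← Finset.sum_coe_sort s (fun a => b (f a))]
    exact Equiv.sum_comp s.equivFin.symm (fun a : s => b (f a))
  rw [e1, e2 F, e3] at h
  exact h

/-- **Proposition (covering estimate):** for an almost-additive, bounded function `F`, a box
`Q` and a decomposition of `Q` into boxes `C_M(a)`, `a ∈ x + (Mℤ)^d`, one has
`‖F(Q) − Σ_{a∈I_{Q,x,M}} F(C_M(a))‖ ≤ |Q| b(C_M)/|C_M| + |D_{Q,x,M}| (C+D) |C_M|`. -/
theorem covering_estimate {X : Type*} [NormedAddCommGroup X]
    (hd : 1 ≤ d) (F : Finset (Zd d) → X) (b : Finset (Zd d) → ℝ) (D : ℝ)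
    (hb : IsBoundaryTerm b D) (hAA : AlmostAdditive F b)
    (C : ℝ) (hCpos : 0 < C) (hBd : Bounded F C)
    (M : ℕ) (hM : 1 ≤ M) (Q : Finset (Zd d)) (hQ : IsBox Q) (x : Zd d) :
    ‖F Q - ∑ a ∈ latticeI Q x M, F (shift a (cube d M))‖ ≤
      (Q.card : ℝ) * (b (cube d M) / ((cube d M).card : ℝ))
      + ((latticeD Q x M).card : ℝ) * ((C + D) * ((cube d M).card : ℝ)) := by
  obtain ⟨hb0, hbs, -, hD, hbD⟩ := hb
  set I := latticeI Q x M with hI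
  set J := latticeD Q x M with hJ
  have mI : ∀ a, a ∈ I ↔ a ∈ coverShifts Q M ∧ (∀ j, (M : ℤ) ∣ (a j - x j)) ∧
      shift a (cube d M) ⊆ Q := fun a => by simp [hI, latticeI]
  have mJ : ∀ a, a ∈ J ↔ a ∈ coverShifts Q M ∧ (∀ j, (M : ℤ) ∣ (a j - x j)) ∧
      ¬ shift a (cube d M) ⊆ Q := fun a => by simp [hJ, latticeD]
  have hdisj : Disjoint I J := by
    rw [Finset.disjoint_left]
    intro a h1 h2
    exact ((mJ a).1 h2).2.2 ((mI a).1 h1).2.2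
  have hlat : ∀ a ∈ I ∪ J, ∀ j, (M : ℤ) ∣ (a j - x j) := by
    intro a ha
    rcases Finset.mem_union.1 ha with h | h
    · exact ((mI a).1 h).2.1
    · exact ((mJ a).1 h).2.1
  have hsd : ∀ a ∈ I ∪ J, ∀ a' ∈ I ∪ J, a ≠ a' →
      Disjoint (shift a (cube d M)) (shift a' (cube d M)) := by
    intro a ha a' ha' hne
    rw [Finset.disjoint_left]
    intro y hy hy'
    exact hne (lattice_unique x a a' y M (hlat a ha) (hlat a' ha') hy hy')
  have hAA' := almostAdditive_finset hAA (I ∪ J) (fun a => shift a (cube d M) ∩ Q)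
    (fun a ha a' ha' hne => (hsd a ha a' ha' hne).mono Finset.inter_subset_left
      Finset.inter_subset_left)
  have hcov : (I ∪ J).biUnion (fun a => shift a (cube d M) ∩ Q) = Q := by
    ext y
    simp only [Finset.mem_biUnion, Finset.mem_inter]
    constructor
    · rintro ⟨a, -, -, h⟩
      exact h
    · intro hy
      obtain ⟨a, ha, hya⟩ := lattice_exists x y M hM
      refine ⟨a, ?_, hya, hy⟩
      have hc : a ∈ coverShifts Q M := (mem_coverShifts Q a M).2 ⟨y, hy, hya⟩
      rw [Finset.mem_union, mI, mJ]
      tauto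
  rw [hcov, Finset.sum_union hdisj, Finset.sum_union hdisj] at hAA'
  have eI : ∀ a ∈ I, shift a (cube d M) ∩ Q = shift a (cube d M) := fun a ha =>
    Finset.inter_eq_left.2 ((mI a).1 ha).2.2
  have e1 : ∑ a ∈ I, F (shift a (cube d M) ∩ Q) = ∑ a ∈ I, F (shift a (cube d M)) :=
    Finset.sum_congr rfl fun a ha => by rw [eI a ha]
  have e2 : ∑ a ∈ I, b (shift a (cube d M) ∩ Q) = I.card * b (cube d M) := by
    rw [Finset.sum_congr rfl fun a ha => by rw [eI a ha, hbs], Finset.sum_const, nsmul_eq_mul]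
  have hcard : ∀ a : Zd d, ((shift a (cube d M) ∩ Q).card : ℝ) ≤ (cube d M).card := fun a => by
    rw [← card_shift a (cube d M)]
    exact_mod_cast Finset.card_le_card Finset.inter_subset_left
  have e3 : ∑ a ∈ J, b (shift a (cube d M) ∩ Q) ≤ J.card * (D * (cube d M).card) := by
    rw [← nsmul_eq_mul]
    exact Finset.sum_le_card_nsmul _ _ _ fun a _ => (hbD _).trans
      (mul_le_mul_of_nonneg_left (hcard a) hD.le)
  have e4 : ‖∑ a ∈ J, F (shift a (cube d M) ∩ Q)‖ ≤ J.card * (C * (cube d M).card) := by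
    refine (norm_sum_le _ _).trans ?_
    rw [← nsmul_eq_mul]
    exact Finset.sum_le_card_nsmul _ _ _ fun a _ => (hBd _).trans
      (mul_le_mul_of_nonneg_left (hcard a) hCpos.le)
  have hpos : (0 : ℝ) < (cube d M).card := by
    have : (cube d M).Nonempty := by
      refine ⟨0, ?_⟩
      simp only [cube, Fintype.mem_piFinset, Finset.mem_Ico, Pi.zero_apply]
      intro j
      omega
    exact_mod_cast this.card_pos
  have e5 : (I.card : ℝ) * (cube d M).card ≤ Q.card := by
    have h1 : (I.biUnion fun a => shift a (cube d M)).card = I.card * (cube d M).card := by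
      rw [Finset.card_biUnion, Finset.sum_congr rfl fun a _ => card_shift a _,
        Finset.sum_const, smul_eq_mul]
      intro a ha a' ha' hne
      exact hsd a (Finset.mem_union_left _ ha) a' (Finset.mem_union_left _ ha') hne
    have h2 : (I.biUnion fun a => shift a (cube d M)).card ≤ Q.card :=
      Finset.card_le_card (Finset.biUnion_subset.2 fun a ha => ((mI a).1 ha).2.2)
    rw [h1] at h2
    exact_mod_cast h2
  have e6 : (I.card : ℝ) * b (cube d M) ≤ Q.card * (b (cube d M) / (cube d M).card) := by
    have := mul_le_mul_of_nonneg_right e5 (div_nonneg (hb0 (cube d M)) hpos.le)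
    calc (I.card : ℝ) * b (cube d M)
        = I.card * (cube d M).card * (b (cube d M) / (cube d M).card) := by field_simp
      _ ≤ _ := this
  rw [e1, e2] at hAA'
  have e7 : F Q - ∑ a ∈ I, F (shift a (cube d M)) =
      (F Q - (∑ a ∈ I, F (shift a (cube d M)) + ∑ a ∈ J, F (shift a (cube d M) ∩ Q)))
        + ∑ a ∈ J, F (shift a (cube d M) ∩ Q) := by abel
  rw [e7]
  refine (norm_add_le _ _).trans ?_
  linarith

end IDSZd
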